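/- For every signed graph G on n vertices, there exists a sequence of at most n³ BED-admissible flips that transforms G into a balanced signed graph. -/

import Mathlib

open Finset

/-- A signed graph on `n` vertices: `true` = friendship (+1), `false` = enmity (−1). -/
abbrev SignedGraph (n : ℕ) := Fin n → Fin n → Bool

/-- The sign assignment is symmetric (it is an assignment to undirected edges). -/
def Symm {n : ℕ} (G : SignedGraph n) : Prop := ∀ u v, G u v = G v u

/-- The triad `{u,v,w}` is balanced: it contains an even number (0 or 2) of enmity edges. -/
def BalancedTriad {n : ℕ} (G : SignedGraph n) (u v w : Fin n) : Prop :=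
  Bool.xor (G u v) (Bool.xor (G v w) (G u w)) = true

instance {n : ℕ} (G : SignedGraph n) (u v w : Fin n) :
    Decidable (BalancedTriad G u v w) :=
  inferInstanceAs (Decidable (_ = true))

/-- The rank of the edge `(u,v)`: the number of imbalanced triads containing it. -/
def rank {n : ℕ} (G : SignedGraph n) (u v : Fin n) : ℕ :=
  (univ.filter (fun w => w ≠ u ∧ w ≠ v ∧ ¬ BalancedTriad G u v w)).card

/-- A signed graph is balanced if every triad is balanced. -/
def IsBalanced {n : ℕ} (G : SignedGraph n) : Prop :=
  ∀ u v w : Fin n, u ≠ v → v ≠ w → u ≠ w → BalancedTriad G u v w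

/-- A signed graph is jammed if it is not balanced and every edge `e`
satisfies `2 * r_e < n - 2`. -/
def IsJammed {n : ℕ} (G : SignedGraph n) : Prop :=
  ¬ IsBalanced G ∧ ∀ u v : Fin n, u ≠ v → 2 * rank G u v < n - 2

/-- Flipping (reversing the sign of) the undirected edge `p`. -/
def flipEdge {n : ℕ} (G : SignedGraph n) (p : Sym2 (Fin n)) : SignedGraph n :=
  fun x y => if s(x, y) = p then !(G x y) else G x y

/-- A CTD-admissible flipEdge: the edge lies in some imbalanced triad and `2 r_e ≥ n - 2`. -/
def CTDAdmissible {n : ℕ} (G : SignedGraph n) (p : Sym2 (Fin n)) : Prop :=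
  ∃ u v : Fin n, p = s(u, v) ∧ u ≠ v ∧
    (∃ w, w ≠ u ∧ w ≠ v ∧ ¬ BalancedTriad G u v w) ∧
    n - 2 ≤ 2 * rank G u v

/-- A BED-admissible flipEdge: there is an imbalanced triad containing the edge
in which the edge has maximal rank. -/
def BEDAdmissible {n : ℕ} (G : SignedGraph n) (p : Sym2 (Fin n)) : Prop :=
  ∃ u v w : Fin n, p = s(u, v) ∧ u ≠ v ∧ w ≠ u ∧ w ≠ v ∧
    ¬ BalancedTriad G u v w ∧
    rank G v w ≤ rank G u v ∧ rank G u w ≤ rank G u v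

/-- `FlipSeq Adm G L H`: the list of edges `L` is a sequence of `Adm`-admissible flips
transforming `G` into `H`. -/
inductive FlipSeq {n : ℕ} (Adm : SignedGraph n → Sym2 (Fin n) → Prop) :
    SignedGraph n → List (Sym2 (Fin n)) → SignedGraph n → Prop
  | nil (G : SignedGraph n) : FlipSeq Adm G [] G
  | cons {G H : SignedGraph n} {L : List (Sym2 (Fin n))} (p : Sym2 (Fin n)) :
      Adm G p → FlipSeq Adm (flipEdge G p) L H → FlipSeq Adm G (p :: L) H

/-- Circular distance between cluster indices. -/
def circDist {m : ℕ} (i j : Fin m) : ℕ := min (i - j : Fin m).val (j - i : Fin m).val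

/-- The circular graph: given a cluster assignment `c`, an edge is a friendship iff
its endpoints lie in clusters at circular distance at most `k`. -/
def circular {n m : ℕ} (c : Fin n → Fin m) (k : ℕ) : SignedGraph n :=
  fun u v => decide (circDist (c u) (c v) ≤ k)

/-- The jammed state `J_n`: three fixed clusters of size `n/3`, friendships inside
clusters, enmities across. -/
def Jn (n : ℕ) : SignedGraph n :=
  fun u v => decide (u.val / (n / 3) = v.val / (n / 3))

/-- The signed graph obtained from `G` by flipping exactly the edges in `F`. -/
def perturb {n : ℕ} (G : SignedGraph n) (F : Finset (Sym2 (Fin n))) : SignedGraph n :=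
  fun u v => if s(u, v) ∈ F then !(G u v) else G u v

/-- The set of (undirected, non-diagonal) edges on which two signed graphs differ. -/
def diffEdges {n : ℕ} (G C : SignedGraph n) : Finset (Sym2 (Fin n)) :=
  univ.filter (fun p => ∃ u v : Fin n, p = s(u, v) ∧ u ≠ v ∧ G u v ≠ C u v)

/-- `C` is a closest balanced state to `G`: `C` is balanced and minimizes the number of
edges on which the signs differ from `G`. -/
def IsClosestBalanced {n : ℕ} (G C : SignedGraph n) : Prop :=
  Symm C ∧ IsBalanced C ∧
    ∀ C' : SignedGraph n, Symm C' → IsBalanced C' →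
      (diffEdges G C).card ≤ (diffEdges G C').card

/-- The two sides of the balanced state `B_n`: clusters `0, 1, 5` versus `2, 3, 4`. -/
def sixPart (i : Fin 6) : Bool := decide (i = 0 ∨ i = 1 ∨ i = 5)

/-- The balanced state `B_n` whose friendship parts are `V₀ ∪ V₁ ∪ V₅` and `V₂ ∪ V₃ ∪ V₄`. -/
def Bgraph {n : ℕ} (c : Fin n → Fin 6) : SignedGraph n :=
  fun u v => sixPart (c u) == sixPart (c v)

/-- The number of good triads containing the red edge `(u,v)`: imbalanced triads in which
the red edge has strictly greater rank than each of the other two edges. -/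
def goodCount {n : ℕ} (G : SignedGraph n) (u v : Fin n) : ℕ :=
  (univ.filter (fun w => w ≠ u ∧ w ≠ v ∧ ¬ BalancedTriad G u v w ∧
    rank G v w < rank G u v ∧ rank G u w < rank G u v)).card

/-- The number of bad triads containing the red edge `(u,v)`: imbalanced triads that
are not good. -/
def badCount {n : ℕ} (G : SignedGraph n) (u v : Fin n) : ℕ :=
  (univ.filter (fun w => w ≠ u ∧ w ≠ v ∧ ¬ BalancedTriad G u v w ∧
    ¬ (rank G v w < rank G u v ∧ rank G u w < rank G u v))).card

/-! The proof maintains a partition of the vertices, encoded by `c : Fin n → Fin n`, all of whose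
classes consist of twins.  Choosing an edge of minimal rank among those joining two classes, one
can lower its rank to zero by admissible flips, which allows the two classes to be merged. -/

variable {n : ℕ}

theorem FlipSeq.append {Adm : SignedGraph n → Sym2 (Fin n) → Prop} {G H K : SignedGraph n}
    {L M : List (Sym2 (Fin n))} (h₁ : FlipSeq Adm G L H) (h₂ : FlipSeq Adm H M K) :
    FlipSeq Adm G (L ++ M) K := by
  induction h₁ with
  | nil G => exact h₂
  | cons p hp _ ih => exact .cons p hp (ih h₂)

theorem flipEdge_perturb (G : SignedGraph n) {F : Finset (Sym2 (Fin n))} {p : Sym2 (Fin n)}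
    (hp : p ∉ F) : flipEdge (perturb G F) p = perturb G (insert p F) := by
  funext x y
  by_cases h : s(x, y) = p
  · simp [flipEdge, perturb, h, hp]
  · simp [flipEdge, perturb, h]

theorem perturb_empty (G : SignedGraph n) : perturb G ∅ = G := by
  funext x y
  simp [perturb]

/-- If every edge of `F₀` remains admissible after flipping any other edges of `F₀`, then all of
`F₀` can be flipped. -/
theorem flipSeq_perturb {Adm : SignedGraph n → Sym2 (Fin n) → Prop} (G : SignedGraph n)
    (F₀ : Finset (Sym2 (Fin n)))
    (h : ∀ F ⊆ F₀, ∀ p ∈ F₀, p ∉ F → Adm (perturb G F) p) :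
    ∃ L, FlipSeq Adm G L (perturb G F₀) ∧ L.length = F₀.card := by
  suffices ∀ F ⊆ F₀, ∃ L, FlipSeq Adm G L (perturb G F) ∧ L.length = F.card from
    this F₀ subset_rfl
  intro F
  induction F using Finset.induction_on with
  | empty => exact fun _ => ⟨[], by rw [perturb_empty]; exact .nil G, by simp⟩
  | insert p F hp ih =>
    intro hF
    rw [Finset.insert_subset_iff] at hF
    obtain ⟨L, hL, hlen⟩ := ih hF.2
    refine ⟨L ++ [p], hL.append (.cons p (h F hF.2 p hF.1 hp) ?_), ?_⟩
    · rw [flipEdge_perturb G hp]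
      exact .nil _
    · simp [hlen, hp]

theorem Symm.perturb {G : SignedGraph n} (hG : Symm G) (F : Finset (Sym2 (Fin n))) :
    Symm (perturb G F) := by
  intro x y
  simp only [_root_.perturb, hG x y, Sym2.eq_swap (a := x)]

theorem Symm.balancedTriad_swap_left {G : SignedGraph n} (hG : Symm G) (x y z : Fin n) :
    BalancedTriad G x y z ↔ BalancedTriad G y x z := by
  unfold BalancedTriad
  rw [hG y x]
  cases G x y <;> cases G y z <;> cases G x z <;> decide

theorem Symm.balancedTriad_swap_right {G : SignedGraph n} (hG : Symm G) (x y z : Fin n) :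
    BalancedTriad G x y z ↔ BalancedTriad G x z y := by
  unfold BalancedTriad
  rw [hG z y]
  cases G x y <;> cases G y z <;> cases G x z <;> decide

/-- Every four vertices span an even number of imbalanced triads. -/
theorem balancedTriad_cocycle (G : SignedGraph n) (x y z w : Fin n) :
    (BalancedTriad G x y z ↔ BalancedTriad G x y w) ↔
      (BalancedTriad G x z w ↔ BalancedTriad G y z w) := by
  unfold BalancedTriad
  cases G x y <;> cases G y z <;> cases G x z <;> cases G x w <;> cases G y w <;> cases G z w <;>
    decide

theorem Symm.rank_comm {G : SignedGraph n} (hG : Symm G) (x y : Fin n) :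
    rank G x y = rank G y x := by
  unfold rank
  congr 1
  ext w
  simp only [mem_filter, mem_univ, true_and, hG.balancedTriad_swap_left x y w]
  tauto

/-- Vertices with the same label are twins: they lie in no common imbalanced triad. -/
def TwinLabelling (G : SignedGraph n) (c : Fin n → Fin n) : Prop :=
  ∀ x y z, x ≠ y → z ≠ x → z ≠ y → c x = c y → BalancedTriad G x y z

namespace TwinLabelling

variable {G : SignedGraph n} {c : Fin n → Fin n}

theorem balancedTriad_congr_left (h : TwinLabelling G c) {x x' y z : Fin n}
    (hx : c x = c x') (hxy : c x ≠ c y) (hxz : c x ≠ c z) :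
    BalancedTriad G x y z ↔ BalancedTriad G x' y z := by
  by_cases hne : x = x'
  · rw [hne]
  · rw [← balancedTriad_cocycle]
    exact iff_of_true (h x x' y hne (by grind) (by grind) hx)
      (h x x' z hne (by grind) (by grind) hx)

theorem balancedTriad_congr_right (h : TwinLabelling G c) (hG : Symm G) {x y z z' : Fin n}
    (hz : c z = c z') (hzx : c z ≠ c x) (hzy : c z ≠ c y) :
    BalancedTriad G x y z ↔ BalancedTriad G x y z' := by
  rw [hG.balancedTriad_swap_right, hG.balancedTriad_swap_left,
    h.balancedTriad_congr_left hz hzx hzy, hG.balancedTriad_swap_left,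
    hG.balancedTriad_swap_right]

theorem label_ne (h : TwinLabelling G c) (hG : Symm G) {x y z : Fin n} (hxy : x ≠ y)
    (hzx : z ≠ x) (hzy : z ≠ y) (hb : ¬ BalancedTriad G x y z) : c z ≠ c x ∧ c z ≠ c y := by
  constructor <;> intro he <;> apply hb
  · rw [hG.balancedTriad_swap_right]
    exact h x z y hzx.symm hxy.symm hzy.symm he.symm
  · rw [hG.balancedTriad_swap_left, hG.balancedTriad_swap_right]
    exact h y z x hzy.symm hxy hzx.symm he.symm

theorem isBalanced (h : TwinLabelling G c) (hc : ∀ x y, c x = c y) : IsBalanced G :=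
  fun x y z hxy hyz hxz => h x y z hxy hxz.symm hyz.symm (hc x y)

/-- Two classes joined by an edge of rank zero can be merged. -/
theorem merge (h : TwinLabelling G c) (hG : Symm G) {u v : Fin n} (huv : c u ≠ c v)
    (hr : rank G u v = 0) : TwinLabelling G (fun x => if c x = c u then c v else c x) := by
  have key : ∀ x y z, x ≠ y → z ≠ x → z ≠ y → c x = c u → c y = c v → BalancedTriad G x y z := by
    intro x y z hxy hzx hzy hx hy
    by_contra hb
    obtain ⟨h₁, h₂⟩ := h.label_ne hG hxy hzx hzy hb
    have hb' : ¬ BalancedTriad G u v z := by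
      rwa [h.balancedTriad_congr_left hx (by grind) (by grind), hG.balancedTriad_swap_left,
        h.balancedTriad_congr_left hy (by grind) (by grind), hG.balancedTriad_swap_left] at hb
    rw [rank, Finset.card_eq_zero, Finset.filter_eq_empty_iff] at hr
    exact hr (mem_univ z) ⟨by grind, by grind, hb'⟩
  intro x y z hxy hzx hzy he
  by_cases hx : c x = c u <;> by_cases hy : c y = c u
  · exact h x y z hxy hzx hzy (hx.trans hy.symm)
  · simp only [hx, hy, if_true, if_false] at he
    exact key x y z hxy hzx hzy hx he.symm
  · simp only [hx, hy, if_true, if_false] at he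
    rw [hG.balancedTriad_swap_left]
    exact key y x z hxy.symm hzy hzx hy he
  · simp only [hx, hy, if_false] at he
    exact h x y z hxy hzx hzy he

end TwinLabelling

/-- The edges joining the classes with labels `a` and `b`. -/
def bundle (c : Fin n → Fin n) (a b : Fin n) : Finset (Sym2 (Fin n)) :=
  ((univ.filter (c · = a)) ×ˢ (univ.filter (c · = b))).image fun q => s(q.1, q.2)

theorem mem_bundle {c : Fin n → Fin n} {a b x y : Fin n} :
    s(x, y) ∈ bundle c a b ↔ (c x = a ∧ c y = b) ∨ (c x = b ∧ c y = a) := by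
  simp only [bundle, mem_image, mem_product, mem_filter, mem_univ, true_and, Prod.exists,
    Sym2.eq_iff]
  grind

theorem card_bundle_le (c : Fin n → Fin n) (a b : Fin n) :
    (bundle c a b).card ≤ n * (univ.filter (c · = b)).card := by
  refine card_image_le.trans ?_
  rw [card_product]
  exact Nat.mul_le_mul_right _ ((card_filter_le _ _).trans (by simp))

theorem perturb_eq_self {G : SignedGraph n} {c : Fin n → Fin n} {a b : Fin n}
    {F : Finset (Sym2 (Fin n))} (hF : F ⊆ bundle c a b) {x y : Fin n}
    (h : ¬((c x = a ∧ c y = b) ∨ (c x = b ∧ c y = a))) : perturb G F x y = G x y :=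
  if_neg fun hm => h (mem_bundle.1 (hF hm))

theorem perturb_bundle {G : SignedGraph n} {c : Fin n → Fin n} {a b x y : Fin n} :
    perturb G (bundle c a b) x y =
      if (c x = a ∧ c y = b) ∨ (c x = b ∧ c y = a) then !(G x y) else G x y := by
  simp only [perturb, mem_bundle]

/-- Flipping a bundle reverses the balance of the triads with exactly one edge in it. -/
theorem balancedTriad_perturb_bundle {G : SignedGraph n} {c : Fin n → Fin n} {a b u v w : Fin n}
    (hua : c u ≠ a) (hub : c u ≠ b) (hv : c v = a) (hw : c w = b) :
    BalancedTriad (perturb G (bundle c a b)) u v w ↔ ¬ BalancedTriad G u v w := by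
  unfold BalancedTriad
  rw [perturb_eq_self subset_rfl (by tauto), perturb_bundle, if_pos (by tauto),
    perturb_eq_self subset_rfl (by tauto)]
  cases G u v <;> cases G v w <;> cases G u w <;> decide

namespace TwinLabelling

variable {G : SignedGraph n} {c : Fin n → Fin n}

theorem perturb_bundle (h : TwinLabelling G c) {a b : Fin n} (hab : a ≠ b) :
    TwinLabelling (perturb G (bundle c a b)) c := by
  intro x y z hxy hzx hzy he
  have hb := h x y z hxy hzx hzy he
  have hne : ¬((c y = a ∧ c y = b) ∨ (c y = b ∧ c y = a)) := by grind
  unfold BalancedTriad at hb ⊢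
  simp only [_root_.perturb_bundle, he, if_neg hne]
  split_ifs
  · revert hb
    cases G x y <;> cases G y z <;> cases G x z <;> decide
  · exact hb

/-- If `xyz` is imbalanced, flipping edges of the bundle containing `xy` cannot increase the rank
of `xz`. -/
theorem rank_perturb_le (h : TwinLabelling G c) (hG : Symm G) {x y z : Fin n}
    (hxy : c x ≠ c y) (hzx : c z ≠ c x) (hzy : c z ≠ c y) (hb : ¬ BalancedTriad G x y z)
    {F : Finset (Sym2 (Fin n))} (hF : F ⊆ bundle c (c x) (c y)) :
    rank (perturb G F) x z ≤ rank G x z := by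
  apply card_le_card
  intro w
  simp only [mem_filter, mem_univ, true_and]
  rintro ⟨hwx, hwz, hw⟩
  refine ⟨hwx, hwz, ?_⟩
  by_cases hwy : c w = c y
  · rwa [hG.balancedTriad_swap_right, hG.balancedTriad_swap_left,
      h.balancedTriad_congr_left hwy (by grind) (by grind), hG.balancedTriad_swap_left]
  · unfold BalancedTriad at hw ⊢
    rwa [perturb_eq_self hF (by grind), perturb_eq_self hF (by grind),
      perturb_eq_self hF (by grind)] at hw

theorem le_rank_perturb (h : TwinLabelling G c) (hG : Symm G) {x y : Fin n} (hxy : c x ≠ c y)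
    {F : Finset (Sym2 (Fin n))} (hF : F ⊆ bundle c (c x) (c y)) (hm : s(x, y) ∉ F) :
    rank G x y ≤ rank (perturb G F) x y := by
  apply card_le_card
  intro w
  simp only [mem_filter, mem_univ, true_and]
  rintro ⟨hwx, hwy, hw⟩
  refine ⟨hwx, hwy, ?_⟩
  obtain ⟨h₁, h₂⟩ := h.label_ne hG (by grind) hwx hwy hw
  have hxy' : perturb G F x y = G x y := if_neg hm
  unfold BalancedTriad at hw ⊢
  rwa [hxy', perturb_eq_self hF (by grind), perturb_eq_self hF (by grind)]

theorem rank_congr (h : TwinLabelling G c) (hG : Symm G) {x x' y : Fin n} (hx : c x = c x')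
    (hxy : c x ≠ c y) : rank G x y = rank G x' y := by
  unfold rank
  congr 1
  ext w
  simp only [mem_filter, mem_univ, true_and]
  constructor
  · rintro ⟨hwx, hwy, hw⟩
    obtain ⟨h₁, h₂⟩ := h.label_ne hG (by grind) hwx hwy hw
    refine ⟨by grind, hwy, ?_⟩
    rwa [← h.balancedTriad_congr_left hx hxy h₁.symm]
  · rintro ⟨hwx, hwy, hw⟩
    obtain ⟨h₁, h₂⟩ := h.label_ne hG (by grind) hwx hwy hw
    refine ⟨by grind, hwy, ?_⟩
    rwa [h.balancedTriad_congr_left hx hxy (by grind)]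

/-- If an edge has maximal rank in an imbalanced triad, its whole bundle can be flipped. -/
theorem flipSeq_bundle (h : TwinLabelling G c) (hG : Symm G) {v w u : Fin n} (hvw : v ≠ w)
    (huv : u ≠ v) (huw : u ≠ w) (hb : ¬ BalancedTriad G v w u) (hc : c v ≠ c w)
    (hr₁ : rank G w u ≤ rank G v w) (hr₂ : rank G v u ≤ rank G v w) :
    ∃ L, FlipSeq BEDAdmissible G L (perturb G (bundle c (c v) (c w))) ∧
      L.length = (bundle c (c v) (c w)).card := by
  obtain ⟨h₁, h₂⟩ := h.label_ne hG hvw huv huw hb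
  apply flipSeq_perturb
  intro F hF p hp hpF
  obtain ⟨⟨x, y⟩, hq, rfl⟩ := mem_image.1 hp
  simp only [mem_product, mem_filter, mem_univ, true_and] at hq
  obtain ⟨hx, hy⟩ := hq
  have hxy : c x ≠ c y := by rwa [hx, hy]
  have hux : c u ≠ c x := by rwa [hx]
  have huy : c u ≠ c y := by rwa [hy]
  rw [← hx, ← hy] at hF
  have hb' : ¬ BalancedTriad G x y u := by
    rwa [h.balancedTriad_congr_left hx hxy hux.symm, hG.balancedTriad_swap_left,
      h.balancedTriad_congr_left hy (by grind) huy.symm, hG.balancedTriad_swap_left]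
  have hvw' : rank G v w = rank G x y := by
    rw [h.rank_congr hG hx.symm hc, hG.rank_comm, h.rank_congr hG hy.symm (by grind),
      hG.rank_comm]
  rw [h.rank_congr hG hy.symm h₂.symm, hvw'] at hr₁
  rw [h.rank_congr hG hx.symm h₁.symm, hvw'] at hr₂
  have hle := h.le_rank_perturb hG hxy hF hpF
  refine ⟨x, y, u, rfl, by grind, by grind, by grind, ?_, ?_, ?_⟩
  · have hxy' : perturb G F x y = G x y := if_neg hpF
    unfold BalancedTriad at hb' ⊢
    rwa [hxy', perturb_eq_self hF (by grind), perturb_eq_self hF (by grind)]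
  · refine (h.rank_perturb_le hG hxy.symm huy hux ?_ ?_).trans (hr₁.trans hle)
    · rwa [hG.balancedTriad_swap_left]
    · intro q hq
      induction q with
      | _ s t =>
        have := mem_bundle.1 (hF hq)
        exact mem_bundle.2 (by tauto)
  · exact (h.rank_perturb_le hG hxy hux huy hb' hF).trans (hr₂.trans hle)

end TwinLabelling

/-- The edge `uv` has minimal rank in each imbalanced triad containing it. -/
def IsLocallyMinimal (G : SignedGraph n) (u v : Fin n) : Prop :=
  ∀ x, x ≠ u → x ≠ v → ¬ BalancedTriad G u v x →
    rank G u v ≤ rank G u x ∧ rank G u v ≤ rank G v x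

theorem IsLocallyMinimal.symm {G : SignedGraph n} {u v : Fin n} (h : IsLocallyMinimal G u v)
    (hG : Symm G) : IsLocallyMinimal G v u := by
  intro x hxv hxu hb
  rw [hG.balancedTriad_swap_left] at hb
  rw [hG.rank_comm v u]
  exact (h x hxu hxv hb).symm

namespace TwinLabelling

variable {G : SignedGraph n} {c : Fin n → Fin n}

/-- Flipping a bundle at `v` balances a class of triads at a locally minimal edge `uv` and keeps
that edge locally minimal. -/
theorem exists_rank_lt_of_le (h : TwinLabelling G c) (hG : Symm G) {u v w : Fin n}
    (huv : c u ≠ c v) (hmin : IsLocallyMinimal G u v) (hwu : w ≠ u) (hwv : w ≠ v)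
    (hb : ¬ BalancedTriad G u v w) (hle : rank G u w ≤ rank G v w) :
    ∃ L H, FlipSeq BEDAdmissible G L H ∧ Symm H ∧ TwinLabelling H c ∧
      IsLocallyMinimal H u v ∧ rank H u v < rank G u v ∧
      L.length + n * rank H u v ≤ n * rank G u v := by
  have huv' : u ≠ v := fun he => huv (by rw [he])
  obtain ⟨hcwu, hcwv⟩ := h.label_ne hG huv' hwu hwv hb
  have hb' : ¬ BalancedTriad G v w u := by
    rwa [hG.balancedTriad_swap_right, hG.balancedTriad_swap_left]
  obtain ⟨L, hL, hlen⟩ := h.flipSeq_bundle hG hwv.symm huv' hwu.symm hb' hcwv.symm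
    (by rwa [hG.rank_comm w u]) (by rw [hG.rank_comm v u]; exact (hmin w hwu hwv hb).2)
  set H := perturb G (bundle c (c v) (c w)) with hH
  have hcard : (univ.filter (c · = c w)).card + rank H u v = rank G u v := by
    unfold rank
    rw [← card_union_of_disjoint]
    · congr 1
      ext z
      simp only [mem_union, mem_filter, mem_univ, true_and]
      by_cases hz : c z = c w
      · simp only [hz, true_or, true_iff]
        refine ⟨by grind, by grind, ?_⟩
        rwa [h.balancedTriad_congr_right hG hz (by grind) (by grind)]
      · simp only [hz, false_or]
        unfold BalancedTriad
        rw [hH, perturb_eq_self subset_rfl (by grind), perturb_eq_self subset_rfl (by grind),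
          perturb_eq_self subset_rfl (by grind)]
    · rw [disjoint_left]
      intro z hz
      simp only [mem_filter, mem_univ, true_and] at hz ⊢
      rintro ⟨hzu, hzv, hbz⟩
      apply hbz
      rwa [hH, balancedTriad_perturb_bundle huv hcwu.symm rfl hz,
        h.balancedTriad_congr_right hG hz (by grind) (by grind)]
  have hpos : 0 < (univ.filter (c · = c w)).card := card_pos.2 ⟨w, by simp⟩
  refine ⟨L, H, hL, hG.perturb _, h.perturb_bundle hcwv.symm, ?_, by omega, ?_⟩
  · intro x hxu hxv hbx
    obtain ⟨hcxu, hcxv⟩ :=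
      (h.perturb_bundle hcwv.symm).label_ne (hG.perturb _) huv' hxu hxv hbx
    have hcxw : c x ≠ c w := by
      intro hxw
      rw [hH, balancedTriad_perturb_bundle huv hcwu.symm rfl hxw,
        h.balancedTriad_congr_right hG hxw (by grind) (by grind)] at hbx
      exact hbx hb
    have hbG : ¬ BalancedTriad G u v x := by
      unfold BalancedTriad at hbx ⊢
      rwa [hH, perturb_eq_self subset_rfl (by grind), perturb_eq_self subset_rfl (by grind),
        perturb_eq_self subset_rfl (by grind)] at hbx
    obtain ⟨hm₁, hm₂⟩ := hmin x hxu hxv hbG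
    have hux : rank G u x ≤ rank H u x := by
      apply card_le_card
      intro z
      simp only [mem_filter, mem_univ, true_and]
      rintro ⟨hzu, hzx, hz⟩
      refine ⟨hzu, hzx, ?_⟩
      unfold BalancedTriad at hz ⊢
      rwa [hH, perturb_eq_self subset_rfl (by grind), perturb_eq_self subset_rfl (by grind),
        perturb_eq_self subset_rfl (by grind)]
    have hvx : rank G v x ≤ (univ.filter (c · = c w)).card + rank H v x := by
      refine (card_le_card ?_).trans (card_union_le _ _)
      intro z
      simp only [mem_union, mem_filter, mem_univ, true_and]
      rintro ⟨hzv, hzx, hz⟩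
      by_cases hzw : c z = c w
      · exact .inl hzw
      · refine .inr ⟨hzv, hzx, ?_⟩
        unfold BalancedTriad at hz ⊢
        rwa [hH, perturb_eq_self subset_rfl (by grind), perturb_eq_self subset_rfl (by grind),
          perturb_eq_self subset_rfl (by grind)]
    omega
  · rw [hlen, ← hcard, mul_add]
    exact Nat.add_le_add_right (card_bundle_le c _ _) _

theorem exists_rank_lt (h : TwinLabelling G c) (hG : Symm G) {u v : Fin n}
    (huv : c u ≠ c v) (hmin : IsLocallyMinimal G u v) (hr : rank G u v ≠ 0) :
    ∃ L H, FlipSeq BEDAdmissible G L H ∧ Symm H ∧ TwinLabelling H c ∧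
      IsLocallyMinimal H u v ∧ rank H u v < rank G u v ∧
      L.length + n * rank H u v ≤ n * rank G u v := by
  obtain ⟨w, hw⟩ := card_pos.1 (Nat.pos_of_ne_zero hr)
  simp only [mem_filter, mem_univ, true_and] at hw
  obtain ⟨hwu, hwv, hb⟩ := hw
  rcases le_total (rank G u w) (rank G v w) with hle | hle
  · exact h.exists_rank_lt_of_le hG huv hmin hwu hwv hb hle
  · obtain ⟨L, H, hL, hH, hT, hm, hlt, hlen⟩ := h.exists_rank_lt_of_le hG huv.symm
      (hmin.symm hG) hwv hwu (by rwa [hG.balancedTriad_swap_left]) hle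
    rw [hH.rank_comm v u, hG.rank_comm v u] at hlt hlen
    exact ⟨L, H, hL, hH, hT, hm.symm hH, hlt, hlen⟩

theorem exists_rank_eq_zero {u v : Fin n} (huv : c u ≠ c v) (r : ℕ) (G : SignedGraph n)
    (h : TwinLabelling G c) (hG : Symm G) (hmin : IsLocallyMinimal G u v)
    (hr : rank G u v = r) :
    ∃ L H, FlipSeq BEDAdmissible G L H ∧ Symm H ∧ TwinLabelling H c ∧
      rank H u v = 0 ∧ L.length ≤ n * r := by
  induction r using Nat.strong_induction_on generalizing G with
  | _ r ih =>
    by_cases hr₀ : rank G u v = 0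
    · exact ⟨[], G, .nil G, hG, h, hr₀, by simp⟩
    · obtain ⟨L, H, hL, hH, hT, hm, hlt, hlen⟩ := h.exists_rank_lt hG huv hmin hr₀
      obtain ⟨M, K, hM, hK, hTK, hK₀, hMlen⟩ := ih _ (hr ▸ hlt) H hT hH hm rfl
      refine ⟨L ++ M, K, hL.append hM, hK, hTK, hK₀, ?_⟩
      rw [List.length_append]
      rw [hr] at hlen
      omega

theorem exists_isBalanced (m : ℕ) (c : Fin n → Fin n) (G : SignedGraph n)
    (h : TwinLabelling G c) (hG : Symm G) (hc : (univ.image c).card ≤ m + 1) :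
    ∃ L H, FlipSeq BEDAdmissible G L H ∧ L.length ≤ m * n ^ 2 ∧ IsBalanced H := by
  induction m generalizing c G with
  | zero =>
    refine ⟨[], G, .nil G, by simp, h.isBalanced fun x y => ?_⟩
    exact card_le_one.1 hc _ (mem_image_of_mem c (mem_univ x)) _ (mem_image_of_mem c (mem_univ y))
  | succ m ih =>
    by_cases hall : ∀ x y, c x = c y
    · exact ⟨[], G, .nil G, by simp, h.isBalanced hall⟩
    push Not at hall
    obtain ⟨x, y, hxy⟩ := hall
    obtain ⟨⟨u, v⟩, huv, hmin⟩ := exists_min_image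
      (univ.filter fun q : Fin n × Fin n => c q.1 ≠ c q.2) (fun q => rank G q.1 q.2)
      ⟨(x, y), by simpa using hxy⟩
    simp only [mem_filter, mem_univ, true_and, Prod.forall] at huv hmin
    have hloc : IsLocallyMinimal G u v := by
      intro z hzu hzv hb
      obtain ⟨h₁, h₂⟩ := h.label_ne hG (by grind) hzu hzv hb
      exact ⟨hmin u z h₁.symm, hmin v z h₂.symm⟩
    obtain ⟨L, H, hL, hH, hT, hr, hlen⟩ := exists_rank_eq_zero huv _ G h hG hloc rfl
    obtain ⟨M, K, hM, hMlen, hK⟩ := ih _ H (hT.merge hH huv hr) hH (by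
      have hsub : univ.image (fun x => if c x = c u then c v else c x) ⊆
          (univ.image c).erase (c u) := by
        intro z
        simp only [mem_image, mem_univ, true_and, mem_erase]
        grind
      have := card_le_card hsub
      rw [card_erase_of_mem (mem_image_of_mem c (mem_univ u))] at this
      omega)
    refine ⟨L ++ M, K, hL.append hM, ?_, hK⟩
    have hrn : rank G u v ≤ n := (card_filter_le _ _).trans (by simp)
    rw [List.length_append]
    nlinarith [Nat.mul_le_mul_left n hrn]

end TwinLabelling

/-- Every signed graph on `n` vertices can be transformed into a balanced
signed graph by a sequence of at most `n³` BED-admissible flips. -/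
theorem bed_reaches_balance (n : ℕ) (G : SignedGraph n) (hG : Symm G) :
    ∃ (L : List (Sym2 (Fin n))) (H : SignedGraph n),
      FlipSeq BEDAdmissible G L H ∧ L.length ≤ n ^ 3 ∧ IsBalanced H := by
  obtain ⟨L, H, hL, hlen, hH⟩ := TwinLabelling.exists_isBalanced n id G
    (fun x y z hxy _ _ he => absurd he hxy) hG (card_image_le.trans (by simp))
  exact ⟨L, H, hL, by rwa [pow_succ' n 2], hH⟩
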